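/- Fix M > 0 with ℳ_M ≠ ∅ and fix α ∈ (0,1), β ∈ (1,∞). Then the set 𝒫 := {P : P ∼ Q and α ≤ dP/dQ ≤ β for some Q ∈ ℳ_M} satisfies Assumption P: 𝒫 is nonempty, convex, compact in the topology of weak convergence of probability measures on ℝ_+^T, and every P ∈ 𝒫 admits some Q ∈ ℳ equivalent to P. -/

import Mathlib

open MeasureTheory Filter Topology Set
open scoped NNReal ENNReal

noncomputable section

/-- The dynamic part of a semi-static trading strategy: for each `j : Fin (T-1)`
(representing the paper's time index `j+1 ∈ {1,…,T-1}`), a function of the first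
`j+1` stock prices `s_1,…,s_{j+1}`. -/
abbrev Strategy (T : ℕ) := (j : Fin (T - 1)) → (Fin (j.1 + 1) → ℝ≥0) → ℝ

/-- Restriction of a path to its first `j+1` coordinates. -/
def restrictPath {T : ℕ} (j : Fin (T - 1)) (ω : Fin T → ℝ≥0) (k : Fin (j.1 + 1)) : ℝ≥0 :=
  ω ⟨k.1, by have h1 := j.isLt; have h2 := k.isLt; omega⟩

/-- Terminal gain `(Δ·S)_T = ∑_{j=1}^{T-1} Δ_j(s_1,…,s_j)(s_{j+1} - s_j)` of a dynamic
strategy (coordinate `i : Fin T` of a path is the stock price `s_{i+1}` at time `i+1`). -/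
def stockGain {T : ℕ} (Δ : Strategy T) (ω : Fin T → ℝ≥0) : ℝ :=
  ∑ j : Fin (T - 1), Δ j (restrictPath j ω) *
    ((ω ⟨j.1 + 1, by have := j.isLt; omega⟩ : ℝ) - (ω ⟨j.1, by have := j.isLt; omega⟩ : ℝ))

/-- Payoff `h·g` of a static option portfolio. -/
def optionGain {T N : ℕ} (g : Fin N → (Fin T → ℝ≥0) → ℝ) (h : Fin N → ℝ) (ω : Fin T → ℝ≥0) : ℝ :=
  ∑ i, h i * g i ω

/-- Terminal wealth `x + (Δ·S)_T + h·g` of a semi-static strategy with initial capital `x`. -/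
def wealth {T N : ℕ} (g : Fin N → (Fin T → ℝ≥0) → ℝ) (x : ℝ) (Δ : Strategy T)
    (h : Fin N → ℝ) (ω : Fin T → ℝ≥0) : ℝ :=
  x + stockGain Δ ω + optionGain g h ω

/-- The σ-algebra generated by the first `k` coordinates, i.e. by `S_1,…,S_k`
(the natural filtration of `S` at time `k`). -/
def Flt (T k : ℕ) : MeasurableSpace (Fin T → ℝ≥0) :=
  MeasurableSpace.comap
    (fun ω (i : Fin (min k T)) => ω ⟨i.1, lt_of_lt_of_le i.isLt (min_le_right k T)⟩) inferInstance

/-- The canonical process `S` is a `Q`-martingale in its natural filtration: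
each `S_i` is integrable and `E_Q[S_{j+1} | S_1,…,S_j] = S_j` for `j = 1,…,T-1`. -/
def IsMartingaleMeasure {T : ℕ} (Q : Measure (Fin T → ℝ≥0)) : Prop :=
  (∀ i : Fin T, Integrable (fun ω => (ω i : ℝ)) Q) ∧
  ∀ j : Fin T, ∀ hj : j.1 + 1 < T,
    Q[(fun ω => (ω ⟨j.1 + 1, hj⟩ : ℝ)) | Flt T (j.1 + 1)] =ᵐ[Q] fun ω => (ω j : ℝ)

/-- The set `ℳ` of martingale measures calibrated to the option prices (all zero). -/
def MartMeasures {T N : ℕ} (g : Fin N → (Fin T → ℝ≥0) → ℝ) : Set (Measure (Fin T → ℝ≥0)) :=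
  {Q | IsProbabilityMeasure Q ∧ IsMartingaleMeasure Q ∧
    ∀ i, Integrable (g i) Q ∧ ∫ ω, g i ω ∂Q = 0}

/-- Two measures are equivalent. -/
def MeasEquiv {Ω : Type*} [MeasurableSpace Ω] (P Q : Measure Ω) : Prop :=
  P ≪ Q ∧ Q ≪ P

/-- Assumption P: `𝒫` is a convex, weakly compact set of (probability) measures, and every
`P ∈ 𝒫` admits an equivalent martingale measure calibrated to the options `g`. -/
structure AssumptionP {T N : ℕ} (g : Fin N → (Fin T → ℝ≥0) → ℝ)
    (𝔓 : Set (ProbabilityMeasure (Fin T → ℝ≥0))) : Prop where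
  convex : ∀ P₁ ∈ 𝔓, ∀ P₂ ∈ 𝔓, ∀ t : ℝ≥0∞, t ≤ 1 → ∃ P ∈ 𝔓,
    (P : Measure (Fin T → ℝ≥0)) =
      t • (P₁ : Measure (Fin T → ℝ≥0)) + (1 - t) • (P₂ : Measure (Fin T → ℝ≥0))
  weaklyCompact : IsCompact 𝔓
  equivMartingale : ∀ P ∈ 𝔓, ∃ Q ∈ MartMeasures g, MeasEquiv (P : Measure (Fin T → ℝ≥0)) Q

/-- The set `ℳ_M` of calibrated martingale measures supported on `[0,M]^T`. -/
def MartMeasuresBdd {T N : ℕ} (g : Fin N → (Fin T → ℝ≥0) → ℝ) (M : ℝ) :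
    Set (Measure (Fin T → ℝ≥0)) :=
  {Q | Q ∈ MartMeasures g ∧ Q {ω | ∃ i, M < (ω i : ℝ)} = 0}

namespace MeasureTheory

/-- A finite measure is dominated by another one as soon as its integrals of all non-negative
bounded continuous functions are. -/
theorem measure_le_of_forall_lintegral_le {Ω : Type*} [TopologicalSpace Ω]
    [TopologicalSpace.PseudoMetrizableSpace Ω] [MeasurableSpace Ω] [BorelSpace Ω]
    {μ ν : Measure Ω} [IsFiniteMeasure μ] [IsFiniteMeasure ν]
    (h : ∀ f : BoundedContinuousFunction Ω ℝ≥0, ∫⁻ x, f x ∂μ ≤ ∫⁻ x, f x ∂ν) : μ ≤ ν := by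
  have hclosed : ∀ F : Set Ω, IsClosed F → μ F ≤ ν F := fun F hF ↦
    le_of_tendsto_of_tendsto' (HasOuterApproxClosed.tendsto_lintegral_apprSeq hF μ)
      (HasOuterApproxClosed.tendsto_lintegral_apprSeq hF ν) fun n ↦ h _
  refine Measure.le_iff.2 fun s hs ↦ ?_
  rw [hs.measure_eq_iSup_isClosed_of_ne_top (measure_ne_top μ s)]
  exact iSup_le fun F ↦ iSup_le fun hFs ↦ iSup_le fun hF ↦
    (hclosed F hF).trans (measure_mono hFs)

/-- Equivalence of `P` and `Q` with a density valued in `[a, b]`, `0 < a`, amounts to the two-sided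
domination `a • Q ≤ P ≤ b • Q`. -/
theorem measEquiv_and_rnDeriv_mem_iff {Ω : Type*} [MeasurableSpace Ω] {P Q : Measure Ω}
    [IsFiniteMeasure P] [IsFiniteMeasure Q] {a b : ℝ≥0∞} (ha : a ≠ 0) :
    (MeasEquiv P Q ∧ ∀ᵐ ω ∂Q, a ≤ P.rnDeriv Q ω ∧ P.rnDeriv Q ω ≤ b) ↔
      a • Q ≤ P ∧ P ≤ b • Q := by
  constructor
  · rintro ⟨⟨hPQ, -⟩, hd⟩
    have h1 : Q.withDensity (fun _ ↦ a) ≤ Q.withDensity (P.rnDeriv Q) :=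
      withDensity_mono (hd.mono fun _ h ↦ h.1)
    have h2 : Q.withDensity (P.rnDeriv Q) ≤ Q.withDensity (fun _ ↦ b) :=
      withDensity_mono (hd.mono fun _ h ↦ h.2)
    rw [withDensity_const, Measure.withDensity_rnDeriv_eq _ _ hPQ] at h1 h2
    exact ⟨h1, h2⟩
  · rintro ⟨h1, h2⟩
    have hPQ : P ≪ Q := Measure.absolutelyContinuous_of_le_smul h2
    refine ⟨⟨hPQ, fun s hs ↦ ?_⟩, ?_⟩
    · have h := (h1 s).trans_eq hs
      simpa [ha] using h
    · have hlo : (fun _ ↦ a) ≤ᵐ[Q] P.rnDeriv Q := by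
        refine ae_le_of_forall_setLIntegral_le_of_sigmaFinite measurable_const fun s hs _ ↦ ?_
        rw [Measure.setLIntegral_rnDeriv hPQ, setLIntegral_const]
        exact h1 s
      have hhi : P.rnDeriv Q ≤ᵐ[Q] fun _ ↦ b := by
        refine ae_le_of_forall_setLIntegral_le_of_sigmaFinite (Measure.measurable_rnDeriv _ _)
          fun s hs _ ↦ ?_
        rw [Measure.setLIntegral_rnDeriv hPQ, setLIntegral_const]
        exact h2 s
      filter_upwards [hlo, hhi] with ω h h' using ⟨h, h'⟩

/-- For finite `μ` and integrable `ℝ≥0`-valued `X`, `Y` with `X` measurable with respect to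
the σ-algebra generated by `p`, one has `E[Y | p] = X` if and only if `X` and `Y` have the same
integral over every event generated by `p`. -/
theorem condExp_comap_ae_eq_iff {Ω E : Type*} [MeasurableSpace Ω] [mE : MeasurableSpace E]
    {μ : Measure Ω} [IsFiniteMeasure μ] {p : Ω → E} (hp : Measurable p) {X Y : Ω → ℝ≥0}
    (hX : Integrable (fun ω ↦ (X ω : ℝ)) μ) (hY : Integrable (fun ω ↦ (Y ω : ℝ)) μ)
    (hXm : Measurable[mE.comap p] X) :
    μ[fun ω ↦ (Y ω : ℝ) | mE.comap p] =ᵐ[μ] (fun ω ↦ (X ω : ℝ)) ↔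
      ∀ B, MeasurableSet B → ∫⁻ ω in p ⁻¹' B, Y ω ∂μ = ∫⁻ ω in p ⁻¹' B, X ω ∂μ := by
  have hm := hp.comap_le
  constructor
  · intro h B hB
    have hB' : MeasurableSet[mE.comap p] (p ⁻¹' B) := ⟨B, hB, rfl⟩
    rw [lintegral_coe_eq_integral _ hY.integrableOn, lintegral_coe_eq_integral _ hX.integrableOn,
      ← setIntegral_condExp hm hY hB', setIntegral_congr_ae (hm _ hB') (h.mono fun _ h _ ↦ h)]
  · intro h
    refine (ae_eq_condExp_of_forall_setIntegral_eq hm hY (fun _ _ _ ↦ hX.integrableOn) ?_ ?_).symm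
    · rintro _ ⟨B, hB, rfl⟩ -
      have h := h B hB
      rw [lintegral_coe_eq_integral _ hY.integrableOn, lintegral_coe_eq_integral _ hX.integrableOn,
        ENNReal.ofReal_eq_ofReal_iff (integral_nonneg fun _ ↦ NNReal.coe_nonneg _)
        (integral_nonneg fun _ ↦ NNReal.coe_nonneg _)] at h
      exact h.symm
    · exact (measurable_coe_nnreal_real.comp hXm).stronglyMeasurable.aestronglyMeasurable

/-- Equality of the integrals of `X` and `Y` over all events generated by a continuous map `p` can
be tested on bounded continuous functions of `p`. -/
theorem forall_setLIntegral_preimage_eq_iff {Ω E : Type*} [MeasurableSpace Ω] [TopologicalSpace E]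
    [TopologicalSpace.PseudoMetrizableSpace E] [MeasurableSpace E] [BorelSpace E]
    {μ : Measure Ω} {p : Ω → E} (hp : Measurable p) {X Y : Ω → ℝ≥0∞}
    (hX : Measurable X) (hY : Measurable Y) (hYi : ∫⁻ ω, Y ω ∂μ ≠ ∞) :
    (∀ B, MeasurableSet B → ∫⁻ ω in p ⁻¹' B, Y ω ∂μ = ∫⁻ ω in p ⁻¹' B, X ω ∂μ) ↔
      ∀ f : BoundedContinuousFunction E ℝ≥0,
        ∫⁻ ω, f (p ω) * Y ω ∂μ = ∫⁻ ω, f (p ω) * X ω ∂μ := by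
  have hset : ∀ {Z : Ω → ℝ≥0∞} {B : Set E}, MeasurableSet B →
      (μ.withDensity Z).map p B = ∫⁻ ω in p ⁻¹' B, Z ω ∂μ := fun hB ↦ by
    rw [Measure.map_apply hp hB, withDensity_apply _ (hp hB)]
  have hinteg : ∀ {Z : Ω → ℝ≥0∞}, Measurable Z → ∀ f : BoundedContinuousFunction E ℝ≥0,
      ∫⁻ e, f e ∂(μ.withDensity Z).map p = ∫⁻ ω, f (p ω) * Z ω ∂μ := fun hZ f ↦ by
    have hf : Measurable fun e ↦ (f e : ℝ≥0∞) :=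
      measurable_coe_nnreal_ennreal.comp f.continuous.measurable
    rw [lintegral_map hf hp]
    refine (lintegral_withDensity_eq_lintegral_mul _ hZ (hf.comp hp)).trans ?_
    simp [mul_comm]
  have : IsFiniteMeasure (μ.withDensity Y) := isFiniteMeasure_withDensity hYi
  constructor
  · intro h f
    rw [← hinteg hX, ← hinteg hY]
    congr 1
    ext B hB
    rw [hset hB, hset hB, h B hB]
  · intro h B hB
    have hmap : (μ.withDensity Y).map p = (μ.withDensity X).map p :=
      ext_of_forall_lintegral_eq_of_IsFiniteMeasure fun f ↦ by rw [hinteg hX, hinteg hY, h f]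
    rw [← hset hB, ← hset hB, hmap]

end MeasureTheory

/-- Truncation of a path at level `m`. -/
def truncPath {T : ℕ} (m : ℝ≥0) (ω : Fin T → ℝ≥0) : Fin T → ℝ≥0 := fun i ↦ min (ω i) m

theorem truncPath_of_le {T : ℕ} {m : ℝ≥0} {ω : Fin T → ℝ≥0} (h : ∀ i, ω i ≤ m) :
    truncPath m ω = ω :=
  funext fun i ↦ min_eq_left (h i)

/-- A continuous function of the truncated path is bounded. -/
theorem exists_boundedContinuousFunction_truncPath {T : ℕ} {α : Type*} [PseudoMetricSpace α]
    (m : ℝ≥0) {h : (Fin T → ℝ≥0) → α} (hh : Continuous h) :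
    ∃ F : BoundedContinuousFunction (Fin T → ℝ≥0) α, ∀ ω, F ω = h (truncPath m ω) := by
  have hc : Continuous (truncPath (T := T) m) := by unfold truncPath; fun_prop
  let c : C(Fin T → ℝ≥0, Icc (0 : Fin T → ℝ≥0) fun _ ↦ m) :=
    ⟨fun ω ↦ ⟨truncPath m ω, fun _ ↦ zero_le, fun _ ↦ min_le_right _ _⟩, by fun_prop⟩
  exact ⟨(BoundedContinuousFunction.mkOfCompact
    (⟨fun x ↦ h x.1, by fun_prop⟩ : C(Icc (0 : Fin T → ℝ≥0) fun _ ↦ m, α))).compContinuous c, fun _ ↦ rfl⟩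

/-- The initial segment of a path that generates `Flt T k`. -/
def initialSegment (T k : ℕ) (ω : Fin T → ℝ≥0) (i : Fin (min k T)) : ℝ≥0 :=
  ω ⟨i.1, lt_of_lt_of_le i.isLt (min_le_right k T)⟩

theorem continuous_initialSegment (T k : ℕ) : Continuous (initialSegment T k) := by
  unfold initialSegment; fun_prop

/-- The martingale property expressed through integrals over the events of the natural filtration,
a formulation that is linear in the measure. -/
theorem isMartingaleMeasure_iff {T : ℕ} {Q : Measure (Fin T → ℝ≥0)} [IsFiniteMeasure Q] :
    IsMartingaleMeasure Q ↔ (∀ i : Fin T, Integrable (fun ω ↦ (ω i : ℝ)) Q) ∧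
      ∀ j : Fin T, ∀ hj : j.1 + 1 < T, ∀ B, MeasurableSet B →
        ∫⁻ ω in initialSegment T (j.1 + 1) ⁻¹' B, ω ⟨j.1 + 1, hj⟩ ∂Q =
          ∫⁻ ω in initialSegment T (j.1 + 1) ⁻¹' B, ω j ∂Q := by
  refine and_congr_right fun hinteg ↦ forall_congr' fun j ↦ forall_congr' fun hj ↦ ?_
  refine condExp_comap_ae_eq_iff (p := initialSegment T (j.1 + 1))
    (continuous_initialSegment T _).measurable (hinteg j) (hinteg ⟨j.1 + 1, hj⟩) ?_
  have hj' : j.1 < min (j.1 + 1) T := lt_min (Nat.lt_succ_self _) j.2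
  exact (measurable_pi_apply (⟨j.1, hj'⟩ : Fin (min (j.1 + 1) T))).comp
    (comap_measurable (initialSegment T (j.1 + 1)))

/-- Calibrated martingale measures supported on a box form a convex set. -/
theorem add_smul_mem_martMeasuresBdd {T N : ℕ} {g : Fin N → (Fin T → ℝ≥0) → ℝ} {M : ℝ}
    {Q₁ Q₂ : Measure (Fin T → ℝ≥0)} (h₁ : Q₁ ∈ MartMeasuresBdd g M)
    (h₂ : Q₂ ∈ MartMeasuresBdd g M) {s t : ℝ≥0∞} (hst : s + t = 1) :
    s • Q₁ + t • Q₂ ∈ MartMeasuresBdd g M := by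
  obtain ⟨⟨hp₁, hm₁, hg₁⟩, hb₁⟩ := h₁
  obtain ⟨⟨hp₂, hm₂, hg₂⟩, hb₂⟩ := h₂
  have hs : s ≠ ∞ := ne_top_of_le_ne_top ENNReal.one_ne_top (hst ▸ le_self_add)
  have ht : t ≠ ∞ := ne_top_of_le_ne_top ENNReal.one_ne_top (hst ▸ le_add_self)
  have hp : IsProbabilityMeasure (s • Q₁ + t • Q₂) := ⟨by simp [hst]⟩
  rw [isMartingaleMeasure_iff] at hm₁ hm₂
  refine ⟨⟨hp, isMartingaleMeasure_iff.2 ⟨fun i ↦ ?_, fun j hj B hB ↦ ?_⟩, fun i ↦ ⟨?_, ?_⟩⟩, ?_⟩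
  · exact ((hm₁.1 i).smul_measure hs).add_measure ((hm₂.1 i).smul_measure ht)
  · simp only [Measure.restrict_add, Measure.restrict_smul, lintegral_add_measure,
      lintegral_smul_measure, hm₁.2 j hj B hB, hm₂.2 j hj B hB]
  · exact ((hg₁ i).1.smul_measure hs).add_measure ((hg₂ i).1.smul_measure ht)
  · rw [integral_add_measure ((hg₁ i).1.smul_measure hs) ((hg₂ i).1.smul_measure ht),
      integral_smul_measure, integral_smul_measure, (hg₁ i).2, (hg₂ i).2]
    simp
  · simp [hb₁, hb₂]

/-- The probability measures supported on the box `[0, m]^T` form a weakly compact set. -/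
theorem isCompact_setOf_measure_exists_lt_eq_zero (T : ℕ) (m : ℝ≥0) :
    IsCompact {Q : ProbabilityMeasure (Fin T → ℝ≥0) |
      (Q : Measure (Fin T → ℝ≥0)) {ω | ∃ i, m < ω i} = 0} := by
  have h := isCompact_setOfPred_probabilityMeasure_mass_eq_compl_isCompact_le
    (E := Fin T → ℝ≥0) (u := fun _ ↦ 0) (K := fun _ ↦ Icc 0 fun _ ↦ m) tendsto_const_nhds
    (fun _ ↦ isCompact_Icc) (Or.inr monotone_const)
  convert h using 1
  have hset : (Icc 0 fun _ ↦ m : Set (Fin T → ℝ≥0))ᶜ = {ω | ∃ i, m < ω i} := by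
    ext ω
    simp [Pi.le_def]
  ext Q
  simp [hset, ProbabilityMeasure.null_iff_toMeasure_null]

/-- Among the probability measures supported on the box `[0, m]^T`, the calibrated martingale
measures are characterized by integrals of bounded continuous functions. -/
theorem mem_martMeasures_iff_of_bdd {T N : ℕ} {g : Fin N → (Fin T → ℝ≥0) → ℝ}
    (hg : ∀ i, Continuous (g i)) {m : ℝ≥0} {Q : Measure (Fin T → ℝ≥0)} [IsProbabilityMeasure Q]
    (hQ : Q {ω | ∃ i, m < ω i} = 0) :
    Q ∈ MartMeasures g ↔
      (∀ j : Fin T, ∀ hj : j.1 + 1 < T,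
        ∀ f : BoundedContinuousFunction (Fin (min (j.1 + 1) T) → ℝ≥0) ℝ≥0,
        ∫⁻ ω, ↑(f (initialSegment T (j.1 + 1) (truncPath m ω)) * truncPath m ω ⟨j.1 + 1, hj⟩) ∂Q =
          ∫⁻ ω, ↑(f (initialSegment T (j.1 + 1) (truncPath m ω)) * truncPath m ω j) ∂Q) ∧
      ∀ i, ∫ ω, g i (truncPath m ω) ∂Q = 0 := by
  have hae : ∀ᵐ ω ∂Q, truncPath m ω = ω := by
    have h : ∀ᵐ ω ∂Q, ¬ ∃ i, m < ω i := measure_eq_zero_iff_ae_notMem.1 hQ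
    filter_upwards [h] with ω hω
    exact truncPath_of_le fun i ↦ not_lt.1 fun hi ↦ hω ⟨i, hi⟩
  have hintegrable : ∀ {h : (Fin T → ℝ≥0) → ℝ}, Continuous h → Integrable h Q := fun {h} hh ↦ by
    obtain ⟨F, hF⟩ := exists_boundedContinuousFunction_truncPath m hh
    exact (F.integrable Q).congr (hae.mono fun ω hω ↦ by rw [hF, hω])
  have hcoord : ∀ i : Fin T, Integrable (fun ω ↦ (ω i : ℝ)) Q := fun i ↦
    hintegrable (by fun_prop)
  have hmeas : ∀ i : Fin T, Measurable fun ω : Fin T → ℝ≥0 ↦ (ω i : ℝ≥0∞) := fun i ↦ by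
    fun_prop
  have hinteg : ∀ i, ∫ ω, g i (truncPath m ω) ∂Q = ∫ ω, g i ω ∂Q := fun i ↦
    integral_congr_ae (hae.mono fun ω hω ↦ by simp only [hω])
  have hlint : ∀ (j i : Fin T) (f : BoundedContinuousFunction (Fin (min (j.1 + 1) T) → ℝ≥0) ℝ≥0),
      ∫⁻ ω, ↑(f (initialSegment T (j.1 + 1) (truncPath m ω)) * truncPath m ω i) ∂Q =
        ∫⁻ ω, f (initialSegment T (j.1 + 1) ω) * ω i ∂Q := fun j i f ↦
    lintegral_congr_ae (hae.mono fun ω hω ↦ by simp only [hω, ENNReal.coe_mul])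
  simp only [hinteg, hlint, MartMeasures, mem_ofPred_eq, isMartingaleMeasure_iff]
  refine ⟨fun ⟨_, h, h'⟩ ↦ ⟨fun j hj ↦ ?_, fun i ↦ (h' i).2⟩,
    fun ⟨h, h'⟩ ↦ ⟨inferInstance, ⟨hcoord, fun j hj ↦ ?_⟩, fun i ↦ ⟨hintegrable (hg i), h' i⟩⟩⟩
  all_goals
    have hfin : ∫⁻ ω : Fin T → ℝ≥0, (ω ⟨j.1 + 1, hj⟩ : ℝ≥0∞) ∂Q ≠ ∞ := by
      rw [lintegral_coe_eq_integral _ (hcoord _)]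
      exact ENNReal.ofReal_ne_top
    have key := forall_setLIntegral_preimage_eq_iff (μ := Q)
      (continuous_initialSegment T (j.1 + 1)).measurable (hmeas j) (hmeas ⟨j.1 + 1, hj⟩) hfin
  · exact key.1 (h.2 j hj)
  · exact key.2 (h j hj)

/-- The calibrated martingale measures supported on `[0, M]^T` form a weakly compact set. -/
theorem isCompact_setOf_coe_mem_martMeasuresBdd {T N : ℕ} {g : Fin N → (Fin T → ℝ≥0) → ℝ}
    (hg : ∀ i, Continuous (g i)) {M : ℝ} (hM : 0 < M) :
    IsCompact {Q : ProbabilityMeasure (Fin T → ℝ≥0) |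
      (Q : Measure (Fin T → ℝ≥0)) ∈ MartMeasuresBdd g M} := by
  lift M to ℝ≥0 using hM.le with m
  set C : Set (ProbabilityMeasure (Fin T → ℝ≥0)) := {Q |
      (∀ j : Fin T, ∀ hj : j.1 + 1 < T,
        ∀ f : BoundedContinuousFunction (Fin (min (j.1 + 1) T) → ℝ≥0) ℝ≥0,
        ∫⁻ ω, ↑(f (initialSegment T (j.1 + 1) (truncPath m ω)) * truncPath m ω ⟨j.1 + 1, hj⟩) ∂Q =
          ∫⁻ ω, ↑(f (initialSegment T (j.1 + 1) (truncPath m ω)) * truncPath m ω j) ∂Q) ∧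
      ∀ i, ∫ ω, g i (truncPath m ω) ∂Q = 0}
  have hC : IsClosed C := by
    have hl : ∀ {h : (Fin T → ℝ≥0) → ℝ≥0}, Continuous h →
        Continuous fun Q : ProbabilityMeasure (Fin T → ℝ≥0) ↦
          ∫⁻ ω, h (truncPath m ω) ∂(Q : Measure (Fin T → ℝ≥0)) := fun {h} hh ↦ by
      obtain ⟨F, hF⟩ := exists_boundedContinuousFunction_truncPath m hh
      simpa only [hF] using ProbabilityMeasure.continuous_lintegral_boundedContinuousFunction F
    have hr : ∀ {h : (Fin T → ℝ≥0) → ℝ}, Continuous h →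
        Continuous fun Q : ProbabilityMeasure (Fin T → ℝ≥0) ↦
          ∫ ω, h (truncPath m ω) ∂(Q : Measure (Fin T → ℝ≥0)) := fun {h} hh ↦ by
      obtain ⟨F, hF⟩ := exists_boundedContinuousFunction_truncPath m hh
      simpa only [hF] using ProbabilityMeasure.continuous_integral_boundedContinuousFunction F
    have hseg : ∀ (j i : Fin T)
        (f : BoundedContinuousFunction (Fin (min (j.1 + 1) T) → ℝ≥0) ℝ≥0),
        Continuous fun ω : Fin T → ℝ≥0 ↦ f (initialSegment T (j.1 + 1) ω) * ω i := fun j i f ↦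
      (f.continuous.comp (continuous_initialSegment T _)).mul (continuous_apply i)
    simp only [C, ofPred_and, ofPred_forall]
    refine IsClosed.inter ?_ ?_
    · exact isClosed_iInter fun j ↦ isClosed_iInter fun hj ↦ isClosed_iInter fun f ↦
        isClosed_eq (hl (hseg j _ f)) (hl (hseg j j f))
    · exact isClosed_iInter fun i ↦ isClosed_eq (hr (hg i)) continuous_const
  convert (isCompact_setOf_measure_exists_lt_eq_zero T m).inter_right hC using 1
  ext Q
  simp only [MartMeasuresBdd, NNReal.coe_lt_coe, mem_ofPred_eq, mem_inter_iff, C]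
  rw [and_comm]
  exact and_congr_right fun h ↦ mem_martMeasures_iff_of_bdd hg h

/-- The order relation between fixed multiples of two probability measures is weakly closed. -/
theorem isClosed_setOf_smul_le_smul {Ω : Type*} [TopologicalSpace Ω]
    [TopologicalSpace.PseudoMetrizableSpace Ω] [MeasurableSpace Ω] [BorelSpace Ω]
    (a b : ℝ≥0) :
    IsClosed {p : ProbabilityMeasure Ω × ProbabilityMeasure Ω |
      (a : ℝ≥0∞) • (p.1 : Measure Ω) ≤ (b : ℝ≥0∞) • (p.2 : Measure Ω)} := by
  have hset : {p : ProbabilityMeasure Ω × ProbabilityMeasure Ω |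
      (a : ℝ≥0∞) • (p.1 : Measure Ω) ≤ (b : ℝ≥0∞) • (p.2 : Measure Ω)} =
      ⋂ f : BoundedContinuousFunction Ω ℝ≥0, {p |
        (a : ℝ≥0∞) * ∫⁻ x, f x ∂(p.1 : Measure Ω) ≤ b * ∫⁻ x, f x ∂(p.2 : Measure Ω)} := by
    ext p
    simp only [mem_ofPred_eq, mem_iInter]
    refine ⟨fun h f ↦ ?_, fun h ↦ ?_⟩
    · simpa only [lintegral_smul_measure, smul_eq_mul] using lintegral_mono' h le_rfl
    · have h₁ := Measure.smul_finite (p.1 : Measure Ω) (ENNReal.coe_ne_top (r := a))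
      have h₂ := Measure.smul_finite (p.2 : Measure Ω) (ENNReal.coe_ne_top (r := b))
      refine measure_le_of_forall_lintegral_le fun f ↦ ?_
      simpa only [lintegral_smul_measure, smul_eq_mul] using h f
  rw [hset]
  have hc (c : ℝ≥0) (f : BoundedContinuousFunction Ω ℝ≥0) :
      Continuous fun P : ProbabilityMeasure Ω ↦ (c : ℝ≥0∞) * ∫⁻ x, f x ∂(P : Measure Ω) :=
    (ENNReal.continuous_const_mul ENNReal.coe_ne_top).comp
      (ProbabilityMeasure.continuous_lintegral_boundedContinuousFunction f)
  exact isClosed_iInter fun f ↦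
    isClosed_le ((hc a f).comp continuous_fst) ((hc b f).comp continuous_snd)

/-- Fix `M > 0` with `ℳ_M ≠ ∅`, `α ∈ (0,1)` and `β ∈ (1,∞)`. Then
`𝒫 := {P : P ∼ Q and α ≤ dP/dQ ≤ β for some Q ∈ ℳ_M}` is nonempty and satisfies
Assumption P (convex, weakly compact, every `P ∈ 𝒫` has an equivalent `Q ∈ ℳ`). -/
theorem exampleP_satisfies_assumptionP
    (T N : ℕ) (g : Fin N → (Fin T → ℝ≥0) → ℝ) (hg : ∀ i, Continuous (g i))
    (M : ℝ) (hM : 0 < M) (hMne : (MartMeasuresBdd g M).Nonempty)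
    (α β : ℝ) (hα : 0 < α) (hα1 : α < 1) (hβ : 1 < β) :
    ({P : ProbabilityMeasure (Fin T → ℝ≥0) | ∃ Q ∈ MartMeasuresBdd g M,
        MeasEquiv (P : Measure (Fin T → ℝ≥0)) Q ∧
        ∀ᵐ ω ∂Q, ENNReal.ofReal α ≤ (P : Measure (Fin T → ℝ≥0)).rnDeriv Q ω ∧
          (P : Measure (Fin T → ℝ≥0)).rnDeriv Q ω ≤ ENNReal.ofReal β} : 
      Set (ProbabilityMeasure (Fin T → ℝ≥0))).Nonempty ∧
    AssumptionP g {P : ProbabilityMeasure (Fin T → ℝ≥0) | ∃ Q ∈ MartMeasuresBdd g M,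
        MeasEquiv (P : Measure (Fin T → ℝ≥0)) Q ∧
        ∀ᵐ ω ∂Q, ENNReal.ofReal α ≤ (P : Measure (Fin T → ℝ≥0)).rnDeriv Q ω ∧
          (P : Measure (Fin T → ℝ≥0)).rnDeriv Q ω ≤ ENNReal.ofReal β} := by
  have ha : ENNReal.ofReal α ≠ 0 := by simpa using hα
  have hmem : ∀ P : ProbabilityMeasure (Fin T → ℝ≥0), (∃ Q ∈ MartMeasuresBdd g M,
        MeasEquiv (P : Measure (Fin T → ℝ≥0)) Q ∧
        ∀ᵐ ω ∂Q, ENNReal.ofReal α ≤ (P : Measure (Fin T → ℝ≥0)).rnDeriv Q ω ∧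
          (P : Measure (Fin T → ℝ≥0)).rnDeriv Q ω ≤ ENNReal.ofReal β) ↔
      ∃ Q ∈ MartMeasuresBdd g M, ENNReal.ofReal α • Q ≤ (P : Measure (Fin T → ℝ≥0)) ∧
        (P : Measure (Fin T → ℝ≥0)) ≤ ENNReal.ofReal β • Q := by
    refine fun P ↦ exists_congr fun Q ↦ and_congr_right fun hQ ↦ ?_
    have := hQ.1.1
    exact measEquiv_and_rnDeriv_mem_iff ha
  refine ⟨?_, ?_, ?_, ?_⟩
  · obtain ⟨Q, hQ⟩ := hMne
    have := hQ.1.1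
    refine ⟨⟨Q, hQ.1.1⟩, Q, hQ, ⟨Measure.AbsolutelyContinuous.rfl,
      Measure.AbsolutelyContinuous.rfl⟩, ?_⟩
    filter_upwards [Measure.rnDeriv_self Q] with ω hω
    simp [hω, hα1.le, hβ.le]
  · simp only [mem_ofPred_eq, hmem]
    rintro P₁ ⟨Q₁, hQ₁, hl₁, hu₁⟩ P₂ ⟨Q₂, hQ₂, hl₂, hu₂⟩ t ht
    have hsmul : ∀ (c : ℝ≥0∞) {μ ν : Measure (Fin T → ℝ≥0)}, μ ≤ ν → c • μ ≤ c • ν :=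
      fun c _ _ h s ↦ mul_le_mul_right (h s) c
    have hadd : t + (1 - t) = 1 := add_tsub_cancel_of_le ht
    refine ⟨⟨t • (P₁ : Measure (Fin T → ℝ≥0)) + (1 - t) • (P₂ : Measure (Fin T → ℝ≥0)),
      ⟨by simp [hadd]⟩⟩, ⟨_, add_smul_mem_martMeasuresBdd hQ₁ hQ₂ hadd, ?_, ?_⟩, rfl⟩
    · rw [smul_add, smul_comm _ t, smul_comm _ (1 - t)]
      exact add_le_add (hsmul t hl₁) (hsmul (1 - t) hl₂)
    · rw [smul_add, smul_comm _ t, smul_comm _ (1 - t)]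
      exact add_le_add (hsmul t hu₁) (hsmul (1 - t) hu₂)
  · simp only [hmem]
    have hcpt := isCompact_setOf_measure_exists_lt_eq_zero T M.toNNReal
    have hcl : IsClosed {p : ProbabilityMeasure (Fin T → ℝ≥0) × ProbabilityMeasure (Fin T → ℝ≥0) |
        ENNReal.ofReal α • (p.2 : Measure (Fin T → ℝ≥0)) ≤ p.1 ∧
          (p.1 : Measure (Fin T → ℝ≥0)) ≤ ENNReal.ofReal β • (p.2 : Measure (Fin T → ℝ≥0))} := by
      refine IsClosed.inter ?_ ?_
      · simpa using! (isClosed_setOf_smul_le_smul α.toNNReal 1).preimage continuous_swap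
      · simpa using! isClosed_setOf_smul_le_smul (Ω := Fin T → ℝ≥0) 1 β.toNNReal
    convert ((hcpt.prod (isCompact_setOf_coe_mem_martMeasuresBdd hg hM)).inter_right hcl).image
      continuous_fst using 1
    ext P
    constructor
    · rintro ⟨Q, hQ, hl, hu⟩
      refine ⟨⟨P, ⟨Q, hQ.1.1⟩⟩, ⟨⟨?_, hQ⟩, hl, hu⟩, rfl⟩
      refine Measure.absolutelyContinuous_of_le_smul hu ?_
      simpa only [Real.toNNReal_lt_iff_lt_coe hM.le] using hQ.2
    · rintro ⟨⟨P, Q⟩, ⟨⟨-, hQ⟩, hl, hu⟩, rfl⟩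
      exact ⟨Q, hQ, hl, hu⟩
  · rintro P ⟨Q, hQ, hPQ, -⟩
    exact ⟨Q, hQ.1, hPQ⟩
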